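/- Let β ∈ (0,2], μ ∈ (1/2,1], s ≥ −1 and T ∈ (0,∞). Define η_β(k,ξ) = ∫₀ᵀ t^{2−2μ} ω_β(k,ξ−tk)^{2(s+1)} e_β(t,k,ξ−tk)² dt. Then there exists a constant c₁ = c₁(β,μ,s,T) > 0 such that η_β(k,ξ) ≤ c₁ · ω_β(k,ξ)^{2(s+1/2−(1−μ))} for all k, ξ ∈ ℝⁿ. -/

import Mathlib

open MeasureTheory Set Filter
open scoped ENNReal

noncomputable section

/-- `ℝⁿ` with the Euclidean norm. -/
abbrev En (n : ℕ) : Type := EuclideanSpace ℝ (Fin n)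

/-- `e_β(t,k,ξ) = exp(−∫₀ᵗ ‖ξ + σ k‖^β dσ)`. -/
def eB (n : ℕ) (β t : ℝ) (k ξ : En n) : ℝ :=
  Real.exp (-(∫ σ in (0:ℝ)..t, ‖ξ + σ • k‖ ^ β))

/-- `ω_β(k,ξ) = 1 + ‖k‖^{β/(β+1)} + ‖ξ‖^β`. -/
def omegaB (n : ℕ) (β : ℝ) (k ξ : En n) : ℝ := 1 + ‖k‖ ^ (β / (β + 1)) + ‖ξ‖ ^ β

lemma two_rpow_le_four {β : ℝ} (hβ : β ≤ 2) : (2:ℝ) ^ β ≤ 4 := by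
  calc (2:ℝ) ^ β ≤ 2 ^ (2:ℝ) := Real.rpow_le_rpow_of_exponent_le (by norm_num) hβ
    _ = 4 := by norm_num

/-- Quasi-subadditivity of `x ↦ x ^ β` for `0 < β ≤ 2`. -/
lemma add_rpow_le_four_mul {β x y : ℝ} (hβ : β ∈ Ioc (0:ℝ) 2) (hx : 0 ≤ x) (hy : 0 ≤ y) :
    (x + y) ^ β ≤ 4 * (x ^ β + y ^ β) := by
  have h2 := two_rpow_le_four hβ.2
  have hx' := Real.rpow_nonneg hx β
  have hy' := Real.rpow_nonneg hy β
  rcases le_total x y with h | h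
  · calc (x + y) ^ β ≤ (2 * y) ^ β := Real.rpow_le_rpow (by positivity) (by linarith) hβ.1.le
      _ = 2 ^ β * y ^ β := Real.mul_rpow (by norm_num) hy
      _ ≤ 4 * (x ^ β + y ^ β) := by nlinarith
  · calc (x + y) ^ β ≤ (2 * x) ^ β := Real.rpow_le_rpow (by positivity) (by linarith) hβ.1.le
      _ = 2 ^ β * x ^ β := Real.mul_rpow (by norm_num) hx
      _ ≤ 4 * (x ^ β + y ^ β) := by nlinarith

/-- Lower bound for the integral of `‖·‖ ^ β` along a segment, by the length of the segment. -/
lemma mul_rpow_le_integral_segment {n : ℕ} {β t : ℝ} (hβ : β ∈ Ioc (0:ℝ) 2) (ht : 0 ≤ t)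
    (k ζ : En n) :
    t * (t * ‖k‖) ^ β ≤ 32 * ∫ σ in (0:ℝ)..t, ‖ζ + σ • k‖ ^ β := by
  have hc : Continuous fun σ : ℝ => ‖ζ + σ • k‖ ^ β :=
    Continuous.rpow_const (by fun_prop) fun _ => Or.inr hβ.1.le
  have hc' : Continuous fun σ : ℝ => ‖ζ + (σ + t / 2) • k‖ ^ β :=
    Continuous.rpow_const (by fun_prop) fun _ => Or.inr hβ.1.le
  have hshift : ∫ σ in (0:ℝ)..(t / 2), ‖ζ + (σ + t / 2) • k‖ ^ β
      = ∫ σ in (t / 2)..t, ‖ζ + σ • k‖ ^ β := by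
    rw [intervalIntegral.integral_comp_add_right (fun σ : ℝ => ‖ζ + σ • k‖ ^ β)]
    congr 1 <;> ring
  have hsplit : ∫ σ in (0:ℝ)..(t / 2), (‖ζ + σ • k‖ ^ β + ‖ζ + (σ + t / 2) • k‖ ^ β)
      = ∫ σ in (0:ℝ)..t, ‖ζ + σ • k‖ ^ β := by
    rw [intervalIntegral.integral_add (hc.intervalIntegrable _ _) (hc'.intervalIntegrable _ _),
      hshift, intervalIntegral.integral_add_adjacent_intervals (hc.intervalIntegrable _ _)
        (hc.intervalIntegrable _ _)]
  have hpt : ∀ σ : ℝ, (t * ‖k‖) ^ β / 16 ≤ ‖ζ + σ • k‖ ^ β + ‖ζ + (σ + t / 2) • k‖ ^ β := by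
    intro σ
    have h1 : t / 2 * ‖k‖ ≤ ‖ζ + σ • k‖ + ‖ζ + (σ + t / 2) • k‖ := by
      calc t / 2 * ‖k‖ = ‖(t / 2) • k‖ := by
            rw [norm_smul, Real.norm_of_nonneg (by positivity)]
        _ = ‖(ζ + (σ + t / 2) • k) - (ζ + σ • k)‖ := by congr 1; module
        _ ≤ _ := (norm_sub_le _ _).trans (add_comm _ _).le
    have h2 : (t / 2 * ‖k‖) ^ β ≤ 4 * (‖ζ + σ • k‖ ^ β + ‖ζ + (σ + t / 2) • k‖ ^ β) :=
      (Real.rpow_le_rpow (by positivity) h1 hβ.1.le).trans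
        (add_rpow_le_four_mul hβ (norm_nonneg _) (norm_nonneg _))
    have h3 : (t * ‖k‖) ^ β ≤ 4 * (t / 2 * ‖k‖) ^ β := by
      rw [show t * ‖k‖ = 2 * (t / 2 * ‖k‖) by ring, Real.mul_rpow (by norm_num) (by positivity)]
      exact mul_le_mul_of_nonneg_right (two_rpow_le_four hβ.2) (by positivity)
    linarith
  have hmono : ∫ _ in (0:ℝ)..(t / 2), (t * ‖k‖) ^ β / 16
      ≤ ∫ σ in (0:ℝ)..(t / 2), (‖ζ + σ • k‖ ^ β + ‖ζ + (σ + t / 2) • k‖ ^ β) :=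
    intervalIntegral.integral_mono_on (by positivity) (by simp)
      ((hc.add hc').intervalIntegrable _ _) fun σ _ => hpt σ
  rw [hsplit, intervalIntegral.integral_const, smul_eq_mul] at hmono
  linarith

/-- Lower bound for the integral of `‖·‖ ^ β` along the segment from `ξ - t • k` to `ξ`. -/
lemma mul_add_rpow_le_integral_segment {n : ℕ} {β t : ℝ} (hβ : β ∈ Ioc (0:ℝ) 2) (ht : 0 ≤ t)
    (k ξ : En n) :
    t * (‖ξ‖ ^ β + (t * ‖k‖) ^ β) ≤ 164 * ∫ σ in (0:ℝ)..t, ‖ξ - t • k + σ • k‖ ^ β := by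
  have hlen := mul_rpow_le_integral_segment hβ ht k (ξ - t • k)
  have hc : Continuous fun σ : ℝ => ‖ξ - t • k + σ • k‖ ^ β :=
    Continuous.rpow_const (by fun_prop) fun _ => Or.inr hβ.1.le
  have hpt : ∀ σ ∈ Icc (0:ℝ) t,
      ‖ξ‖ ^ β / 4 - (t * ‖k‖) ^ β ≤ ‖ξ - t • k + σ • k‖ ^ β := by
    intro σ hσ
    have h1 : ‖ξ‖ ≤ ‖ξ - t • k + σ • k‖ + t * ‖k‖ := by
      calc ‖ξ‖ = ‖(ξ - t • k + σ • k) + (t - σ) • k‖ := by congr 1; module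
        _ ≤ ‖ξ - t • k + σ • k‖ + ‖(t - σ) • k‖ := norm_add_le _ _
        _ ≤ _ := by
          rw [norm_smul, Real.norm_of_nonneg (by linarith [hσ.2])]
          gcongr
          linarith [hσ.1]
    have h2 := (Real.rpow_le_rpow (norm_nonneg _) h1 hβ.1.le).trans
      (add_rpow_le_four_mul hβ (norm_nonneg _) (by positivity))
    linarith
  have hmono := intervalIntegral.integral_mono_on ht (μ := volume)
    (f := fun _ => ‖ξ‖ ^ β / 4 - (t * ‖k‖) ^ β) (by simp) (hc.intervalIntegrable _ _) hpt
  rw [intervalIntegral.integral_const, smul_eq_mul] at hmono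
  linarith

lemma one_le_omegaB (n : ℕ) (β : ℝ) (k ξ : En n) : 1 ≤ omegaB n β k ξ := by
  unfold omegaB
  have h1 : 0 ≤ ‖k‖ ^ (β / (β + 1)) := by positivity
  have h2 : 0 ≤ ‖ξ‖ ^ β := by positivity
  linarith

lemma rpow_div_add_one_rpow {β x : ℝ} (hβ : 0 < β) (hx : 0 ≤ x) :
    (x ^ (β / (β + 1))) ^ (β + 1) = x ^ β := by
  rw [← Real.rpow_mul hx, div_mul_cancel₀ _ (by positivity)]

/-- The weight `ω_β(k, ξ)` controls the transport exponent from below. -/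
lemma mul_omegaB_sub_le {n : ℕ} {β t T : ℝ} (hβ : 0 < β) (ht : 0 ≤ t) (htT : t ≤ T)
    (k ξ : En n) :
    t * omegaB n β k ξ - (1 + T) ≤ t * (‖ξ‖ ^ β + (t * ‖k‖) ^ β) := by
  set x := t * ‖k‖ ^ (β / (β + 1)) with hx
  have hx0 : 0 ≤ x := by positivity
  have hpow : x ^ (β + 1) = t * (t * ‖k‖) ^ β := by
    rw [hx, Real.mul_rpow ht (by positivity), rpow_div_add_one_rpow hβ (norm_nonneg k),
      Real.mul_rpow ht (norm_nonneg k), Real.rpow_add_one' ht (by positivity)]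
    ring
  have hle : x - 1 ≤ x ^ (β + 1) := by
    rcases le_total x 1 with h | h
    · linarith [Real.rpow_nonneg hx0 (β + 1)]
    · linarith [Real.self_le_rpow_of_one_le h (by linarith : 1 ≤ β + 1)]
  unfold omegaB
  nlinarith

/-- Growth of the weight along the characteristics. -/
lemma omegaB_sub_smul_le {n : ℕ} {β t : ℝ} (hβ : β ∈ Ioc (0:ℝ) 2) (ht : 0 ≤ t) (k ξ : En n) :
    omegaB n β k (ξ - t • k) ≤ 8 * omegaB n β k ξ * (1 + t * omegaB n β k ξ) ^ (2:ℝ) := by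
  have hω := one_le_omegaB n β k ξ
  set ω := omegaB n β k ξ with hωdef
  have hy : 0 ≤ t * ω := by positivity
  have hk : 0 ≤ ‖k‖ ^ (β / (β + 1)) := by positivity
  have hξ : 0 ≤ ‖ξ‖ ^ β := by positivity
  have h1 : ‖ξ - t • k‖ ^ β ≤ 4 * (‖ξ‖ ^ β + (t * ‖k‖) ^ β) := by
    refine (Real.rpow_le_rpow (norm_nonneg _) ?_ hβ.1.le).trans
      (add_rpow_le_four_mul hβ (norm_nonneg _) (by positivity))
    refine (norm_sub_le _ _).trans ?_
    rw [norm_smul, Real.norm_of_nonneg ht]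
  have h2 : (t * ‖k‖) ^ β ≤ ω * (t * ω) ^ β := by
    have hkω : ‖k‖ ^ (β / (β + 1)) ≤ ω := by rw [hωdef, omegaB]; linarith
    have : ‖k‖ ^ β ≤ ω ^ (β + 1) := by
      rw [← rpow_div_add_one_rpow hβ.1 (norm_nonneg k)]
      exact Real.rpow_le_rpow hk hkω (by linarith [hβ.1])
    rw [Real.rpow_add_one' (by linarith) (by linarith [hβ.1])] at this
    rw [Real.mul_rpow ht (norm_nonneg k), Real.mul_rpow ht (by linarith)]
    calc t ^ β * ‖k‖ ^ β ≤ t ^ β * (ω ^ β * ω) := by gcongr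
      _ = _ := by ring
  have h3 : (t * ω) ^ β ≤ (1 + t * ω) ^ (2:ℝ) :=
    (Real.rpow_le_rpow hy (by linarith) hβ.1.le).trans
      (Real.rpow_le_rpow_of_exponent_le (by linarith) hβ.2)
  have h4 : 1 ≤ (1 + t * ω) ^ (2:ℝ) := Real.one_le_rpow (by linarith) (by norm_num)
  have h5 : omegaB n β k (ξ - t • k) ≤ 4 * ω + 4 * (t * ‖k‖) ^ β := by
    rw [hωdef]; unfold omegaB; linarith
  nlinarith [mul_le_mul_of_nonneg_left h3 (by linarith : 0 ≤ ω),
    mul_le_mul_of_nonneg_left h4 (by linarith : 0 ≤ ω)]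

/-- Powers are dominated by exponentials of any positive rate. -/
lemma one_add_rpow_le_mul_exp {c p : ℝ} (hc : 0 < c) (hc1 : c ≤ 1) (hp : 0 ≤ p) :
    ∃ C : ℝ, 0 < C ∧ ∀ y : ℝ, 0 ≤ y → (1 + y) ^ p ≤ C * Real.exp (c * y) := by
  have hp1 : 0 < p + 1 := by linarith
  set δ := c / (p + 1) with hδ
  have hδ0 : 0 < δ := by positivity
  have hδ1 : δ ≤ 1 := by rw [hδ, div_le_one hp1]; linarith
  have hδc : δ * p ≤ c := by
    rw [hδ, div_mul_eq_mul_div, div_le_iff₀ hp1]; nlinarith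
  refine ⟨(1 / δ) ^ p, by positivity, fun y hy => ?_⟩
  have h1 : 1 + y ≤ 1 / δ * Real.exp (δ * y) := by
    rw [one_div, ← div_eq_inv_mul, le_div_iff₀ hδ0]
    nlinarith [Real.add_one_le_exp (δ * y)]
  calc (1 + y) ^ p ≤ (1 / δ * Real.exp (δ * y)) ^ p := Real.rpow_le_rpow (by linarith) h1 hp
    _ = (1 / δ) ^ p * Real.exp (δ * y * p) := by
      rw [Real.mul_rpow (by positivity) (Real.exp_pos _).le, ← Real.exp_mul]
    _ ≤ (1 / δ) ^ p * Real.exp (c * y) := by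
      refine mul_le_mul_of_nonneg_left (Real.exp_le_exp.2 ?_) (by positivity)
      nlinarith

/-- Pointwise bound of the weighted semigroup along characteristics. -/
lemma omegaB_rpow_mul_eB_sq_le {β T γ : ℝ} (hβ : β ∈ Ioc (0:ℝ) 2) (hγ : 0 ≤ γ) :
    ∃ K : ℝ, 0 < K ∧ ∀ (n : ℕ) (k ξ : En n) (t : ℝ), 0 ≤ t → t ≤ T →
      omegaB n β k (ξ - t • k) ^ γ * eB n β t k (ξ - t • k) ^ 2
        ≤ K * omegaB n β k ξ ^ γ * Real.exp (-((1 / 164) * omegaB n β k ξ * t)) := by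
  obtain ⟨C, hC, hexp⟩ := one_add_rpow_le_mul_exp (c := 1 / 164) (p := 2 * γ)
    (by norm_num) (by norm_num) (by positivity)
  refine ⟨8 ^ γ * C * Real.exp ((1 + T) / 82), by positivity, fun n k ξ t ht htT => ?_⟩
  have hω := one_le_omegaB n β k ξ
  have hω' := one_le_omegaB n β k (ξ - t • k)
  have h1 := omegaB_sub_smul_le hβ ht k ξ
  have h2 := mul_omegaB_sub_le hβ.1 ht htT k ξ
  have h3 := mul_add_rpow_le_integral_segment hβ ht k ξ
  set ω := omegaB n β k ξ with hωdef
  have hω0 : 0 ≤ ω := by linarith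
  have hy : 0 ≤ t * ω := by positivity
  have hE : eB n β t k (ξ - t • k) ^ 2 ≤ Real.exp ((1 + T) / 82) * Real.exp (-(t * ω / 82)) := by
    unfold eB
    rw [← Real.exp_nat_mul, ← Real.exp_add]
    apply Real.exp_le_exp.2
    push_cast
    linarith
  have hW : omegaB n β k (ξ - t • k) ^ γ ≤ 8 ^ γ * ω ^ γ * (C * Real.exp (1 / 164 * (t * ω))) := by
    calc omegaB n β k (ξ - t • k) ^ γ ≤ (8 * ω * (1 + t * ω) ^ (2:ℝ)) ^ γ :=
          Real.rpow_le_rpow (by linarith) h1 hγ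
      _ = 8 ^ γ * ω ^ γ * (1 + t * ω) ^ (2 * γ) := by
        rw [Real.mul_rpow (by positivity) (by positivity), Real.mul_rpow (by norm_num) hω0,
          ← Real.rpow_mul (by linarith)]
      _ ≤ _ := by gcongr; exact hexp _ hy
  calc omegaB n β k (ξ - t • k) ^ γ * eB n β t k (ξ - t • k) ^ 2
      ≤ (8 ^ γ * ω ^ γ * (C * Real.exp (1 / 164 * (t * ω))))
        * (Real.exp ((1 + T) / 82) * Real.exp (-(t * ω / 82))) := by gcongr
    _ = 8 ^ γ * C * Real.exp ((1 + T) / 82) * ω ^ γ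
        * (Real.exp (1 / 164 * (t * ω)) * Real.exp (-(t * ω / 82))) := by ring
    _ = _ := by
      rw [← Real.exp_add]
      congr 2
      ring

lemma lintegral_rpow_mul_exp_neg_mul_Ioi {p r : ℝ} (hp : -1 < p) (hr : 0 < r) :
    ∫⁻ t in Ioi (0:ℝ), ENNReal.ofReal (t ^ p * Real.exp (-(r * t)))
      = ENNReal.ofReal ((1 / r) ^ (p + 1) * Real.Gamma (p + 1)) := by
  have hval := Real.integral_rpow_mul_exp_neg_mul_Ioi (by linarith : 0 < p + 1) hr
  rw [add_sub_cancel_right] at hval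
  have hpos : 0 < (1 / r) ^ (p + 1) * Real.Gamma (p + 1) :=
    mul_pos (by positivity) (Real.Gamma_pos_of_pos (by linarith))
  have hint : Integrable (fun t : ℝ => t ^ p * Real.exp (-(r * t))) (volume.restrict (Ioi 0)) := by
    by_contra h
    rw [integral_undef h] at hval
    linarith
  rw [← hval, ofReal_integral_eq_lintegral_ofReal hint]
  filter_upwards [ae_restrict_mem measurableSet_Ioi] with t ht
  have : (0:ℝ) < t := ht
  positivity

theorem stmt3 (n : ℕ) (hn : 1 ≤ n) (β μ s T : ℝ) (hβ : β ∈ Ioc (0:ℝ) 2)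
    (hμ : μ ∈ Ioc (1/2 : ℝ) 1) (hs : (-1:ℝ) ≤ s) (hT : 0 < T) :
    ∃ c₁ : ℝ, 0 < c₁ ∧ ∀ k ξ : En n,
      (∫⁻ t in Ioo (0:ℝ) T, ENNReal.ofReal
          (t ^ (2 - 2*μ) * omegaB n β k (ξ - t • k) ^ (2 * (s + 1)) * eB n β t k (ξ - t • k) ^ 2))
        ≤ ENNReal.ofReal (c₁ * omegaB n β k ξ ^ (2 * (s + 1/2 - (1 - μ)))) := by
  obtain ⟨K, hK, hbound⟩ :=
    omegaB_rpow_mul_eB_sq_le (T := T) (γ := 2 * (s + 1)) hβ (by linarith)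
  have hp : 0 < 2 - 2 * μ + 1 := by linarith [hμ.2]
  have hΓ : 0 < Real.Gamma (2 - 2 * μ + 1) := Real.Gamma_pos_of_pos hp
  refine ⟨K * (164 ^ (2 - 2 * μ + 1) * Real.Gamma (2 - 2 * μ + 1)), by positivity,
    fun k ξ => ?_⟩
  have hω := one_le_omegaB n β k ξ
  set ω := omegaB n β k ξ with hωdef
  have hω0 : 0 < ω := by linarith
  calc ∫⁻ t in Ioo (0:ℝ) T, ENNReal.ofReal
          (t ^ (2 - 2*μ) * omegaB n β k (ξ - t • k) ^ (2 * (s + 1)) * eB n β t k (ξ - t • k) ^ 2)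
      ≤ ∫⁻ t in Ioo (0:ℝ) T, ENNReal.ofReal (K * ω ^ (2 * (s + 1)))
          * ENNReal.ofReal (t ^ (2 - 2 * μ) * Real.exp (-((1 / 164) * ω * t))) := by
        refine setLIntegral_mono' measurableSet_Ioo fun t ht => ?_
        rw [← ENNReal.ofReal_mul (by positivity)]
        apply ENNReal.ofReal_le_ofReal
        have htp : 0 ≤ t ^ (2 - 2 * μ) := Real.rpow_nonneg ht.1.le _
        calc _ = t ^ (2 - 2 * μ) * (omegaB n β k (ξ - t • k) ^ (2 * (s + 1))
                * eB n β t k (ξ - t • k) ^ 2) := by ring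
          _ ≤ t ^ (2 - 2 * μ) * (K * ω ^ (2 * (s + 1)) * Real.exp (-((1 / 164) * ω * t))) :=
            mul_le_mul_of_nonneg_left (hbound n k ξ t ht.1.le ht.2.le) htp
          _ = _ := by ring
    _ ≤ ∫⁻ t in Ioi (0:ℝ), ENNReal.ofReal (K * ω ^ (2 * (s + 1)))
          * ENNReal.ofReal (t ^ (2 - 2 * μ) * Real.exp (-((1 / 164) * ω * t))) :=
        lintegral_mono_set Ioo_subset_Ioi_self
    _ = ENNReal.ofReal (K * ω ^ (2 * (s + 1))
          * ((1 / (1 / 164 * ω)) ^ (2 - 2 * μ + 1) * Real.Gamma (2 - 2 * μ + 1))) := by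
        rw [lintegral_const_mul' _ _ ENNReal.ofReal_ne_top,
          lintegral_rpow_mul_exp_neg_mul_Ioi (by linarith) (by positivity),
          ← ENNReal.ofReal_mul (by positivity)]
    _ = _ := by
        congr 1
        have h1 : 1 / (1 / 164 * ω) = 164 / ω := by field_simp
        have h2 : 2 * (s + 1 / 2 - (1 - μ)) = 2 * (s + 1) - (2 - 2 * μ + 1) := by ring
        rw [h1, h2, Real.rpow_sub hω0, Real.div_rpow (by norm_num) hω0.le]
        ring
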